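/- arXiv:math/0208236 — 3 statements merged into one kernel-verified Lean document; each statement's English description precedes it below -/
import Mathlib

section
/- Fix a constant c > 0. For every ε > 0 there exists x₀ such that for all real x ≥ x₀, the number of positive integers n ≤ x with ω(n) > c·√(log x / log log x) is at most x / exp((c/2 − ε)·√(log x · log log x)). -/
/-- The multiplicative function `n ↦ m ^ ω(n)`. -/
noncomputable def powCardPrimeFactors (m : ℕ) : ArithmeticFunction ℝ :=
  ⟨fun n ↦ if n = 0 then 0 else (m : ℝ) ^ n.primeFactors.card, by simp⟩

lemma powCardPrimeFactors_apply (m : ℕ) {n : ℕ} (hn : n ≠ 0) :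
    powCardPrimeFactors m n = (m : ℝ) ^ n.primeFactors.card := by
  simp [powCardPrimeFactors, hn]

lemma succ_pow_card_primeFactors_le (m : ℕ) {n : ℕ} (hn : n ≠ 0) :
    ((m : ℝ) + 1) ^ n.primeFactors.card ≤ ∑ d ∈ n.divisors, (m : ℝ) ^ d.primeFactors.card := by
  have hprime : ∀ s ∈ n.primeFactors.powerset, (∏ p ∈ s, p).primeFactors = s := fun s hs ↦
    Nat.primeFactors_prod fun p hp ↦
      Nat.prime_of_mem_primeFactors (Finset.mem_powerset.1 hs hp)
  have hinj : Set.InjOn (fun s : Finset ℕ ↦ ∏ p ∈ s, p) n.primeFactors.powerset := by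
    intro s hs t ht hst
    rw [← hprime s hs, ← hprime t ht]
    exact congrArg Nat.primeFactors hst
  calc ((m : ℝ) + 1) ^ n.primeFactors.card
      = ∑ s ∈ n.primeFactors.powerset, (m : ℝ) ^ (∏ p ∈ s, p).primeFactors.card := by
        rw [← Finset.sum_pow_mul_eq_add_pow]
        exact Finset.sum_congr rfl fun s hs ↦ by simp [hprime s hs]
    _ = ∑ d ∈ n.primeFactors.powerset.image (fun s ↦ ∏ p ∈ s, p),
          (m : ℝ) ^ d.primeFactors.card := by rw [Finset.sum_image hinj]
    _ ≤ _ := by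
        refine Finset.sum_le_sum_of_subset_of_nonneg ?_ fun _ _ _ ↦ by positivity
        intro d hd
        obtain ⟨s, hs, rfl⟩ := Finset.mem_image.1 hd
        exact Nat.mem_divisors.2 ⟨(Finset.prod_dvd_prod_of_subset _ _ _
          (Finset.mem_powerset.1 hs)).trans n.prod_primeFactors_dvd, hn⟩

lemma sum_pow_card_primeFactors_le (m N : ℕ) :
    ∑ n ∈ Finset.Ioc 0 N, (m : ℝ) ^ n.primeFactors.card ≤ N * (1 + Real.log N) ^ m := by
  induction m generalizing N with
  | zero =>
    calc ∑ n ∈ Finset.Ioc 0 N, ((0 : ℕ) : ℝ) ^ n.primeFactors.card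
        ≤ ∑ n ∈ Finset.Ioc 0 N, (1 : ℝ) :=
          Finset.sum_le_sum fun n _ ↦ pow_le_one₀ (by simp) (by simp)
      _ = _ := by simp
  | succ m ih =>
    have hlog : 0 ≤ Real.log N := Real.log_natCast_nonneg N
    have hharm : ∑ d ∈ Finset.Ioc 0 N, (d : ℝ)⁻¹ ≤ 1 + Real.log N := by
      have h := harmonic_le_one_add_log N
      simp only [harmonic_eq_sum_Icc, Rat.cast_sum, Rat.cast_inv, Rat.cast_natCast] at h
      exact h
    calc ∑ n ∈ Finset.Ioc 0 N, ((m + 1 : ℕ) : ℝ) ^ n.primeFactors.card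
        ≤ ∑ n ∈ Finset.Ioc 0 N,
            ((ArithmeticFunction.zeta : ArithmeticFunction ℝ) * powCardPrimeFactors m) n := by
          refine Finset.sum_le_sum fun n hn ↦ ?_
          have hn0 : n ≠ 0 := (Finset.mem_Ioc.1 hn).1.ne'
          rw [ArithmeticFunction.coe_zeta_mul_apply]
          push_cast
          refine (succ_pow_card_primeFactors_le m hn0).trans_eq ?_
          exact Finset.sum_congr rfl fun d hd ↦
            (powCardPrimeFactors_apply m (Nat.pos_of_mem_divisors hd).ne').symm
      _ = ∑ d ∈ Finset.Ioc 0 N, ∑ n ∈ Finset.Ioc 0 (N / d), (m : ℝ) ^ n.primeFactors.card := by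
          rw [ArithmeticFunction.sum_Ioc_mul_eq_sum_sum]
          refine Finset.sum_congr rfl fun d hd ↦ ?_
          rw [ArithmeticFunction.natCoe_apply,
            ArithmeticFunction.zeta_apply_ne (Finset.mem_Ioc.1 hd).1.ne', Nat.cast_one, one_mul]
          exact Finset.sum_congr rfl fun n hn ↦
            powCardPrimeFactors_apply m (Finset.mem_Ioc.1 hn).1.ne'
      _ ≤ ∑ d ∈ Finset.Ioc 0 N, (N * (1 + Real.log N) ^ m) * (d : ℝ)⁻¹ := by
          refine Finset.sum_le_sum fun d _ ↦ (ih (N / d)).trans ?_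
          have hlog_le : Real.log (N / d : ℕ) ≤ Real.log N := by
            rcases Nat.eq_zero_or_pos (N / d) with h | h
            · simpa [h] using hlog
            · exact Real.log_le_log (by exact_mod_cast h) (by exact_mod_cast Nat.div_le_self N d)
          have hlog_nonneg : 0 ≤ Real.log (N / d : ℕ) := Real.log_natCast_nonneg _
          calc ((N / d : ℕ) : ℝ) * (1 + Real.log (N / d : ℕ)) ^ m
              ≤ (N / d : ℝ) * (1 + Real.log N) ^ m := by
                gcongr
                exact Nat.cast_div_le
            _ = _ := by ring
      _ = (N * (1 + Real.log N) ^ m) * ∑ d ∈ Finset.Ioc 0 N, (d : ℝ)⁻¹ := by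
          rw [Finset.mul_sum]
      _ ≤ (N * (1 + Real.log N) ^ m) * (1 + Real.log N) := by gcongr
      _ = _ := by ring

/-- Rankin's bound for the number of `n ≤ x` with more than `t` prime divisors. -/
lemma ncard_lt_card_primeFactors_le {x t : ℝ} (hx : 1 ≤ x) {m : ℕ} (hm : 1 ≤ m) :
    ({n : ℕ | 0 < n ∧ (n : ℝ) ≤ x ∧ t < (n.primeFactors.card : ℝ)}.ncard : ℝ) ≤
      x * (1 + Real.log x) ^ m / (m : ℝ) ^ t := by
  have hm' : (1 : ℝ) ≤ m := by exact_mod_cast hm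
  have hset : {n : ℕ | 0 < n ∧ (n : ℝ) ≤ x ∧ t < (n.primeFactors.card : ℝ)} =
      {n ∈ Finset.Ioc 0 ⌊x⌋₊ | t < (n.primeFactors.card : ℝ)} := by
    ext n
    simp [Nat.le_floor_iff (zero_le_one.trans hx), and_assoc]
  rw [hset, Set.ncard_coe_finset, le_div_iff₀ (by positivity)]
  have hfloor : 1 ≤ ⌊x⌋₊ := Nat.le_floor (by simpa using hx)
  calc _ = ∑ n ∈ Finset.Ioc 0 ⌊x⌋₊ with t < (n.primeFactors.card : ℝ), (m : ℝ) ^ t := by simp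
    _ ≤ ∑ n ∈ Finset.Ioc 0 ⌊x⌋₊ with t < (n.primeFactors.card : ℝ),
          (m : ℝ) ^ n.primeFactors.card := by
        refine Finset.sum_le_sum fun n hn ↦ ?_
        rw [← Real.rpow_natCast]
        exact Real.rpow_le_rpow_of_exponent_le hm' (Finset.mem_filter.1 hn).2.le
    _ ≤ ∑ n ∈ Finset.Ioc 0 ⌊x⌋₊, (m : ℝ) ^ n.primeFactors.card :=
        Finset.sum_le_sum_of_subset_of_nonneg (Finset.filter_subset _ _)
          fun _ _ _ ↦ by positivity
    _ ≤ ⌊x⌋₊ * (1 + Real.log ⌊x⌋₊) ^ m := sum_pow_card_primeFactors_le m _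
    _ ≤ _ := by
        have hle : (⌊x⌋₊ : ℝ) ≤ x := Nat.floor_le (zero_le_one.trans hx)
        have hpos : (0 : ℝ) < ⌊x⌋₊ := by exact_mod_cast hfloor
        have hlog := Real.log_natCast_nonneg ⌊x⌋₊
        gcongr

open Filter in
lemma eventually_add_mul_log_le (a b : ℝ) {e : ℝ} (he : 0 < e) :
    ∀ᶠ y : ℝ in atTop, a + b * Real.log y ≤ e * y := by
  have hlog := (Real.isLittleO_log_id_atTop.const_mul_left b).def (half_pos he)
  filter_upwards [hlog, eventually_ge_atTop 0, eventually_ge_atTop (2 * a / e)] with y h1 h0 h2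
  rw [div_le_iff₀ he] at h2
  simp only [id, Real.norm_eq_abs, abs_of_nonneg h0] at h1
  linarith [le_abs_self (b * Real.log y)]

open Filter in
theorem count_many_prime_factors (c : ℝ) (hc : 0 < c) :
    ∀ ε : ℝ, 0 < ε → ∃ x₀ : ℝ, ∀ x : ℝ, x ≥ x₀ →
      ({n : ℕ | 0 < n ∧ (n : ℝ) ≤ x ∧
          c * Real.sqrt (Real.log x / Real.log (Real.log x)) <
            (n.primeFactors.card : ℝ)}.ncard : ℝ)
        ≤ x / Real.exp ((c/2 - ε) * Real.sqrt (Real.log x * Real.log (Real.log x))) := by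
  intro ε hε
  set δ : ℝ := ε / 8 with hδ
  have hδ0 : 0 < δ := by positivity
  have hloglog : Tendsto (fun x : ℝ ↦ Real.log (Real.log x)) atTop atTop :=
    Real.tendsto_log_atTop.comp Real.tendsto_log_atTop
  obtain ⟨x₀, hx₀⟩ := eventually_atTop.1 <|
    (eventually_ge_atTop (1 : ℝ)).and <| (Real.tendsto_log_atTop.eventually_ge_atTop 2).and <|
    (hloglog.eventually_ge_atTop 1).and <|
    (hloglog.eventually (eventually_add_mul_log_le (-2 * Real.log δ) 1 one_pos)).and
    (hloglog.eventually (eventually_add_mul_log_le (-c * Real.log δ) (c / 2) (half_pos hε)))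
  refine ⟨x₀, fun x hx ↦ ?_⟩
  obtain ⟨hx1, hL, hy, hδs, hcδ⟩ := hx₀ x hx
  set L := Real.log x with hLdef
  set y := Real.log L with hydef
  set s := Real.sqrt (L / y) with hsdef
  have hL0 : 0 < L := by linarith
  have hy0 : 0 < y := by linarith
  have hs0 : 0 < s := Real.sqrt_pos.2 (by positivity)
  have hsqrt : Real.sqrt (L * y) = s * y := by
    rw [show L * y = L / y * y ^ 2 by field_simp, Real.sqrt_mul (by positivity),
      Real.sqrt_sq hy0.le]
  have hlogs : Real.log (δ * s) = Real.log δ + (y - Real.log y) / 2 := by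
    rw [Real.log_mul hδ0.ne' hs0.ne', hsdef, Real.log_sqrt (by positivity),
      Real.log_div hL0.ne' hy0.ne']
  have hδs1 : 1 ≤ δ * s := by
    rw [← Real.log_nonneg_iff (by positivity), hlogs]
    linarith
  set m := ⌈δ * s⌉₊ with hm
  have hle_m : δ * s ≤ m := Nat.le_ceil _
  have hm_le : (m : ℝ) ≤ 2 * (δ * s) := by
    linarith [Nat.ceil_lt_add_one (zero_le_one.trans hδs1)]
  have hm1 : 1 ≤ m := by exact_mod_cast hδs1.trans hle_m
  have hm0 : (0 : ℝ) < m := by exact_mod_cast hm1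
  have hlogm : Real.log δ + (y - Real.log y) / 2 ≤ Real.log m :=
    hlogs ▸ Real.log_le_log (by positivity) hle_m
  have hlogL : Real.log (1 + L) ≤ 2 * y := by
    rw [hydef, ← Nat.cast_two, ← Real.log_pow]
    exact Real.log_le_log (by positivity) (by nlinarith)
  have hupper : m * Real.log (1 + L) ≤ ε / 2 * (s * y) := by
    calc m * Real.log (1 + L) ≤ (2 * (δ * s)) * (2 * y) :=
          mul_le_mul hm_le hlogL (Real.log_nonneg (by linarith)) (by positivity)
      _ = ε / 2 * (s * y) := by rw [hδ]; ring
  have hlower : (c / 2 - ε / 2) * (s * y) ≤ c * s * Real.log m := by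
    calc (c / 2 - ε / 2) * (s * y) = s * (c / 2 * y - ε / 2 * y) := by ring
      _ ≤ s * (c * Real.log m) := by
          gcongr
          nlinarith [mul_le_mul_of_nonneg_left hlogm hc.le]
      _ = _ := by ring
  refine (ncard_lt_card_primeFactors_le hx1 hm1).trans ?_
  rw [hsqrt, mul_div_assoc, div_eq_mul_inv x, ← Real.exp_neg]
  gcongr
  rw [← Real.exp_log (show 0 < 1 + Real.log x by positivity), ← Real.exp_nat_mul,
    Real.rpow_def_of_pos hm0, ← Real.exp_sub]
  gcongr
  linarith
end

section
/- For every real x ≥ 2 and every integer j ≥ 1, the number of positive integers n ≤ x with ω(n) ≥ j is at most x · (Σ_{p^a ≤ x} 1/p^a)^j / j!, where the sum is over all prime powers p^a ≤ x (p prime, a ≥ 1). -/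
open Finset in
/-- If `n` has at least `j` prime factors, all in `P`, then at least `j!` of the `j`-tuples in `P`
have a product dividing `n`, namely the tuples of distinct prime factors of `n`. -/
theorem factorial_le_card_piFinset_prod_dvd {n j : ℕ} {P : Finset ℕ}
    (hP : n.primeFactors ⊆ P) (hj : j ≤ n.primeFactors.card) :
    j.factorial ≤ #{f ∈ Fintype.piFinset (fun _ : Fin j => P) | ∏ i, f i ∣ n} := by
  calc j.factorial ≤ n.primeFactors.card.descFactorial j := by
        rw [← Nat.descFactorial_self j]
        exact Nat.descFactorial_le j hj
    _ = #(univ : Finset (Fin j ↪ n.primeFactors)) := by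
        rw [card_univ, Fintype.card_embedding_eq]
        simp
    _ ≤ _ := by
        refine card_le_card_of_injOn (fun e i => (e i : ℕ)) (fun e _ => ?_) ?_
        · have hprod : ∏ i, (e i : ℕ) ∣ n := by
            refine Finset.prod_dvd_of_isRelPrime (fun i _ k _ hik => ?_)
              (fun i _ => Nat.dvd_of_mem_primeFactors (e i).2)
            rw [Function.onFun, ← Nat.coprime_iff_isRelPrime]
            exact (Nat.coprime_primes (Nat.prime_of_mem_primeFactors (e i).2)
              (Nat.prime_of_mem_primeFactors (e k).2)).2
              fun h => hik (e.injective (Subtype.ext h))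
          simpa using ⟨fun i => hP (e i).2, hprod⟩
        · intro e _ e' _ h
          ext i
          exact congrFun h i

open Finset in
/-- At most `x / d` positive integers up to `x` are divisible by `d`. -/
theorem card_filter_dvd_Icc_le (x : ℝ) (hx : 0 ≤ x) (d : ℕ) :
    (#{n ∈ Icc 1 ⌊x⌋₊ | d ∣ n} : ℝ) ≤ x * (1 / d) := by
  have h : #{n ∈ Icc 1 ⌊x⌋₊ | d ∣ n} = ⌊x⌋₊ / d := Nat.Ioc_filter_dvd_card_eq_div _ _
  rw [h, mul_one_div]
  exact Nat.cast_div_le.trans (by gcongr; exact Nat.floor_le hx)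

open Finset in
/-- Counting pairs of an integer `n ≤ x` and a `j`-tuple in `P` whose product divides `n`. -/
theorem factorial_mul_card_le_mul_sum_pow (x : ℝ) (hx : 0 ≤ x) (j : ℕ) {P : Finset ℕ}
    (hP : ∀ p, p.Prime → p ≤ ⌊x⌋₊ → p ∈ P) :
    (j.factorial : ℝ) * #{n ∈ Icc 1 ⌊x⌋₊ | j ≤ n.primeFactors.card} ≤
      x * (∑ m ∈ P, (1 : ℝ) / m) ^ j := by
  set A := {n ∈ Icc 1 ⌊x⌋₊ | j ≤ n.primeFactors.card}
  set F := Fintype.piFinset (fun _ : Fin j => P)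
  have hcount : j.factorial * #A ≤ ∑ f ∈ F, #{n ∈ A | ∏ i, f i ∣ n} := by
    calc j.factorial * #A = ∑ n ∈ A, j.factorial := by simp [mul_comm]
      _ ≤ ∑ n ∈ A, #{f ∈ F | ∏ i, f i ∣ n} := by
          refine sum_le_sum fun n hn => ?_
          obtain ⟨hn, hjn⟩ := mem_filter.1 hn
          obtain ⟨hn1, hnx⟩ := mem_Icc.1 hn
          exact factorial_le_card_piFinset_prod_dvd
            (fun p hp => hP p (Nat.prime_of_mem_primeFactors hp)
              ((Nat.le_of_mem_primeFactors hp).trans hnx)) hjn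
      _ = _ := sum_card_bipartiteAbove_eq_sum_card_bipartiteBelow _
  calc (j.factorial : ℝ) * #A ≤ ∑ f ∈ F, (#{n ∈ A | ∏ i, f i ∣ n} : ℝ) := by
        exact_mod_cast hcount
    _ ≤ ∑ f ∈ F, x * (1 / (∏ i, f i : ℕ)) := by
        refine sum_le_sum fun f _ => le_trans ?_ (card_filter_dvd_Icc_le x hx _)
        gcongr
        exact filter_subset _ _
    _ = x * (∑ m ∈ P, (1 : ℝ) / m) ^ j := by
        rw [← mul_sum, Finset.sum_pow']
        simp [F]

theorem count_omega_ge_j (x : ℝ) (hx : 2 ≤ x) (j : ℕ) (hj : 1 ≤ j) :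
    ({n : ℕ | 0 < n ∧ (n : ℝ) ≤ x ∧ j ≤ n.primeFactors.card}.ncard : ℝ) ≤
      x * (∑ m ∈ (Finset.Icc 1 ⌊x⌋₊).filter (fun m => IsPrimePow m), (1 : ℝ) / m) ^ j
        / (j.factorial : ℝ) := by
  have hx0 : 0 ≤ x := by linarith
  have hset : {n : ℕ | 0 < n ∧ (n : ℝ) ≤ x ∧ j ≤ n.primeFactors.card} =
      ((Finset.Icc 1 ⌊x⌋₊).filter (fun n => j ≤ n.primeFactors.card) : Finset ℕ) := by
    ext n
    simp [Nat.le_floor_iff hx0, Nat.succ_le_iff, and_assoc]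
  rw [hset, Set.ncard_coe_finset, le_div_iff₀ (by positivity), mul_comm]
  refine factorial_mul_card_le_mul_sum_pow x hx0 j fun p hp hpx => ?_
  exact Finset.mem_filter.2 ⟨Finset.mem_Icc.2 ⟨hp.one_le, hpx⟩, hp.isPrimePow⟩
end

section
/- Let p be a prime, and let Q be the set of all positive integers q of the form q = p·ℓ_r^{h_r}·ℓ_{r−1}^{h_{r−1}}⋯ℓ_1^{h_1}, where ℓ_1, …, ℓ_r are distinct primes different from p, h_1, …, h_r ≥ 1, and the prime powers satisfy p > ℓ_r^{h_r} > ℓ_{r−1}^{h_{r−1}} > ⋯ > ℓ_1^{h_1} (the case r = 0, i.e. q = p, included). For each q ∈ Q define the residue a(q) modulo q by the Chinese Remainder Theorem via: a(q) ≡ ℓ_r^{h_r} (mod p); a(q) ≡ ℓ_{j−1}^{h_{j−1}} (mod ℓ_j^{h_j}) for 2 ≤ j ≤ r; and a(q) ≡ 0 (mod ℓ_1^{h_1}) (when r = 0, take a(q) ≡ 1 (mod p)). Then for any two distinct q, q′ ∈ Q, the arithmetic progressions a(q) (mod q) and a(q′) (mod q′) are disjoint as subsets of ℤ. -/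
/-- The arithmetic progression `a (mod q)` as a subset of the integers. -/
def ap (a : ℤ) (q : ℕ) : Set ℤ := {m : ℤ | ∃ n : ℤ, m = a + (q : ℤ) * n}

/-- The prime-power components of `q` other than the one at the prime `p`,
listed in increasing order: for `q = p·ℓ_r^{h_r}⋯ℓ_1^{h_1}` this is the list
`[ℓ_1^{h_1}, …, ℓ_r^{h_r}]`. -/
def comps (p q : ℕ) : List ℕ :=
  ((q.primeFactors.erase p).image (fun ℓ => ℓ ^ q.factorization ℓ)).sort (· ≤ ·)

theorem comps_prod {p q : ℕ} (hq : q ≠ 0) (h : q.factorization p = 1) :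
    p * (comps p q).prod = q := by
  have hinj : Set.InjOn (fun ℓ => ℓ ^ q.factorization ℓ) (q.primeFactors.erase p : Finset ℕ) := by
    intro x hx y hy hxy
    simp only [Finset.coe_erase, Set.mem_sdiff, Finset.mem_coe] at hx hy
    have hxp := Nat.prime_of_mem_primeFactors hx.1
    have hyp := Nat.prime_of_mem_primeFactors hy.1
    have hpos : q.factorization x ≠ 0 :=
      (hxp.factorization_pos_of_dvd hq (Nat.dvd_of_mem_primeFactors hx.1)).ne'
    exact (Nat.prime_dvd_prime_iff_eq hxp hyp).1
      (hxp.dvd_of_dvd_pow ((dvd_pow_self x hpos).trans (dvd_of_eq hxy)))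
  have hmem : p ∈ q.primeFactors := by
    rw [← Nat.support_factorization, Finsupp.mem_support_iff, h]
    exact one_ne_zero
  have hsort : (comps p q).prod = ∏ ℓ ∈ q.primeFactors.erase p, ℓ ^ q.factorization ℓ := by
    rw [← Finset.prod_image (f := fun x => x) hinj, ← Multiset.prod_coe, comps,
      Finset.sort_eq, Finset.prod, Multiset.map_id']
  have hfac := Finset.mul_prod_erase q.primeFactors (fun ℓ => ℓ ^ q.factorization ℓ) hmem
  rw [h, pow_one] at hfac
  rw [hsort, hfac]
  exact Nat.prod_factorization_pow_eq_self hq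

theorem exists_prime_of_mem_comps {p q c : ℕ} (hc : c ∈ comps p q) :
    ∃ ℓ : ℕ, ℓ.Prime ∧ ℓ ≠ p ∧ ℓ ∣ q ∧ ℓ ^ q.factorization ℓ = c := by
  simp only [comps, Finset.mem_sort, Finset.mem_image, Finset.mem_erase,
    Nat.mem_primeFactors] at hc
  obtain ⟨ℓ, ⟨hne, hℓ, hdvd, -⟩, rfl⟩ := hc
  exact ⟨ℓ, hℓ, hne, hdvd, rfl⟩

theorem dvd_of_mem_comps {p q c : ℕ} (hc : c ∈ comps p q) : c ∣ q := by
  obtain ⟨ℓ, -, -, -, rfl⟩ := exists_prime_of_mem_comps hc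
  exact Nat.ordProj_dvd q ℓ

theorem one_lt_of_mem_comps {p q c : ℕ} (hq : q ≠ 0) (hc : c ∈ comps p q) : 1 < c := by
  obtain ⟨ℓ, hℓ, -, hdvd, rfl⟩ := exists_prime_of_mem_comps hc
  exact Nat.one_lt_pow (hℓ.factorization_pos_of_dvd hq hdvd).ne' hℓ.one_lt

/-- `x` is the least nonnegative residue of `m` modulo `y`. -/
def IsLeastResidue (m : ℤ) (y x : ℕ) : Prop := x < y ∧ m ≡ x [ZMOD y]

theorem IsLeastResidue.unique {m : ℤ} {y x x' : ℕ} (h : IsLeastResidue m y x)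
    (h' : IsLeastResidue m y x') : x = x' :=
  Nat.ModEq.eq_of_lt_of_lt (Int.natCast_modEq_iff.1 (h.2.symm.trans h'.2)) h.1 h'.1

/-- A chain of successive least residues ending in `0` is determined by its first term. -/
theorem eq_of_isChain_isLeastResidue {m : ℤ} : ∀ {x : ℕ} {l l' : List ℕ},
    (x :: l).IsChain (IsLeastResidue m) → (x :: l').IsChain (IsLeastResidue m) →
    (x :: l).getLast? = some 0 → (x :: l').getLast? = some 0 → l = l'
  | _, [], [], _, _, _, _ => rfl
  | x, [], y :: t, _, h', hl, _ => by
    have hx : x = 0 := by simpa using hl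
    have := (List.isChain_cons_cons.1 h').1.1
    omega
  | x, y :: t, [], h, _, _, hl => by
    have hx : x = 0 := by simpa using hl
    have := (List.isChain_cons_cons.1 h).1.1
    omega
  | x, y :: t, y' :: t', h, h', hl, hl' => by
    obtain ⟨hy, ht⟩ := List.isChain_cons_cons.1 h
    obtain ⟨hy', ht'⟩ := List.isChain_cons_cons.1 h'
    obtain rfl := hy.unique hy'
    rw [List.getLast?_cons_cons] at hl hl'
    rw [eq_of_isChain_isLeastResidue ht ht' hl hl']

theorem isChain_reverse_comps {p q : ℕ} {m b : ℤ} (hq : q ≠ 0) (hm : m ≡ b [ZMOD q])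
    (hhead : ∀ h : comps p q ≠ [], b ≡ 0 [ZMOD (((comps p q).head h : ℕ) : ℤ)])
    (hget : ∀ i : ℕ, ∀ hi : i + 1 < (comps p q).length,
      b ≡ (((comps p q).get ⟨i, Nat.lt_of_succ_lt hi⟩ : ℕ) : ℤ)
        [ZMOD (((comps p q).get ⟨i + 1, hi⟩ : ℕ) : ℤ)]) :
    (0 :: comps p q).reverse.IsChain (IsLeastResidue m) := by
  have hmod : ∀ c ∈ comps p q, m ≡ b [ZMOD c] := fun c hc =>
    hm.of_dvd (Int.natCast_dvd_natCast.2 (dvd_of_mem_comps hc))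
  have hlt : (comps p q).SortedLT := Finset.sortedLT_sort _
  rw [List.isChain_reverse, List.isChain_iff_getElem]
  intro i hi
  rw [List.length_cons] at hi
  rcases i with _ | i
  · have hne : comps p q ≠ [] := List.ne_nil_of_length_pos (by omega)
    have hz := hhead hne
    rw [List.head_eq_getElem] at hz
    have hmem : (comps p q)[0] ∈ comps p q := List.getElem_mem _
    exact ⟨Nat.zero_lt_of_lt (one_lt_of_mem_comps hq hmem), (hmod _ hmem).trans hz⟩
  · exact ⟨hlt.strictMono_get (Fin.mk_lt_mk.2 (Nat.lt_succ_self i)),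
      (hmod _ (List.getElem_mem _)).trans (hget i (Nat.lt_of_succ_lt_succ hi))⟩

theorem erdos_szemeredi_construction_disjoint
    (p : ℕ) (hp : p.Prime)
    (Q : Set ℕ)
    (hQ : Q = {q : ℕ | 0 < q ∧ p ∣ q ∧ q.factorization p = 1 ∧
      ∀ ℓ : ℕ, ℓ.Prime → ℓ ≠ p → ℓ ∣ q → ℓ ^ q.factorization ℓ < p})
    (a : ℕ → ℤ)
    -- the residue `a q` is chosen by the Chinese Remainder Theorem:
    -- writing `comps p q = [ℓ_1^{h_1}, …, ℓ_r^{h_r}]` with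
    -- `p > ℓ_r^{h_r} > ⋯ > ℓ_1^{h_1}`, we require
    -- `a q ≡ ℓ_r^{h_r} (mod p)` (and `a q ≡ 1 (mod p)` when `r = 0`),
    -- `a q ≡ ℓ_{j-1}^{h_{j-1}} (mod ℓ_j^{h_j})` for `2 ≤ j ≤ r`, and
    -- `a q ≡ 0 (mod ℓ_1^{h_1})`.
    (ha : ∀ q ∈ Q,
      (a q ≡ (((comps p q).getLastD 1 : ℕ) : ℤ) [ZMOD (p : ℤ)]) ∧
      (∀ h : comps p q ≠ [], a q ≡ 0 [ZMOD (((comps p q).head h : ℕ) : ℤ)]) ∧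
      (∀ i : ℕ, ∀ hi : i + 1 < (comps p q).length,
        a q ≡ (((comps p q).get ⟨i, by omega⟩ : ℕ) : ℤ)
          [ZMOD (((comps p q).get ⟨i + 1, hi⟩ : ℕ) : ℤ)]))
    (q q' : ℕ) (hq : q ∈ Q) (hq' : q' ∈ Q) (hne : q ≠ q') :
    ap (a q) q ∩ ap (a q') q' = ∅ := by
  rw [Set.eq_empty_iff_forall_notMem]
  rintro m ⟨⟨n, hn⟩, ⟨n', hn'⟩⟩
  have key : ∀ q ∈ Q, m ≡ a q [ZMOD q] → p * (comps p q).prod = q ∧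
      (∀ c ∈ comps p q, 1 < c) ∧ IsLeastResidue m p ((comps p q).getLastD 1) ∧
      (0 :: comps p q).reverse.IsChain (IsLeastResidue m) := by
    intro q hq hm
    obtain ⟨hlast, hhead, hget⟩ := ha q hq
    rw [hQ] at hq
    obtain ⟨hpos, hdvd, hfac, hlt⟩ := hq
    refine ⟨comps_prod hpos.ne' hfac, fun c => one_lt_of_mem_comps hpos.ne',
      ⟨?_, (hm.of_dvd (Int.natCast_dvd_natCast.2 hdvd)).trans hlast⟩,
      isChain_reverse_comps hpos.ne' hm hhead hget⟩
    rcases List.eq_nil_or_concat (comps p q) with h | ⟨l, c, h⟩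
    · simpa [h] using hp.one_lt
    · have hc : c ∈ comps p q := by simp [h]
      obtain ⟨ℓ, hℓ, hℓp, hℓq, rfl⟩ := exists_prime_of_mem_comps hc
      simpa [h] using hlt ℓ hℓ hℓp hℓq
  obtain ⟨hprod, hone, hres, hchain⟩ := key q hq (by simp [hn, Int.ModEq])
  obtain ⟨hprod', hone', hres', hchain'⟩ := key q' hq' (by simp [hn', Int.ModEq])
  have hlast := hres.unique hres'
  refine hne (hprod.symm.trans (Eq.trans ?_ hprod'))
  congr 2
  rcases List.eq_nil_or_concat (comps p q) with h | ⟨l, c, h⟩ <;>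
    rcases List.eq_nil_or_concat (comps p q') with h' | ⟨l', c', h'⟩ <;>
    rw [h] at hlast hone hchain ⊢ <;> rw [h'] at hlast hone' hchain' ⊢
  · have := hone' c' (by simp)
    simp at hlast
    omega
  · have := hone c (by simp)
    simp at hlast
    omega
  · obtain rfl : c = c' := by simpa using hlast
    simp only [List.concat_eq_append, List.reverse_cons, List.reverse_append, List.reverse_nil,
      List.nil_append, List.cons_append] at hchain hchain'
    have hzero : ∀ l : List ℕ, (c :: (l.reverse ++ [0])).getLast? = some 0 := fun l => by
      rw [← List.cons_append, List.getLast?_concat]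
    have := eq_of_isChain_isLeastResidue hchain hchain' (hzero l) (hzero l')
    simpa using this
end
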